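/- Let A(x,y) = y² and B(x,y) = −(2/√27) y³ tan(2√3 x) (corresponding to the implicit ODE p³ + y²p = (2/√27)y³ tan(2√3 x)). Then 4A³ + 27B² = 4y⁶/cos²(2√3 x) wherever cos(2√3 x) ≠ 0, and on the open set {(x,y) : y ≠ 0, cos(2√3 x) ≠ 0} the Chern connection form γ is closed: ∂γ₁/∂y = ∂γ₂/∂x. Hence this 3-web is flat. -/

import Mathlib

/-- Coefficients of the homogeneous normal form
`p³ + y²p = (2/√27) y³ tan(2√3 x)`. -/
noncomputable def Aform : ℝ × ℝ → ℝ := fun z => z.2 ^ 2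
noncomputable def Bform : ℝ × ℝ → ℝ := fun z =>
  -((2 / Real.sqrt 27) * z.2 ^ 3 * Real.tan (2 * Real.sqrt 3 * z.1))

/-- First component `γ₁` of the Chern connection form. -/
noncomputable def gamma1 : ℝ × ℝ → ℝ := fun z =>
  (2 * (Aform z) ^ 2 * fderiv ℝ Aform z (1, 0) - 4 * (Aform z) ^ 2 * fderiv ℝ Bform z (0, 1)
    + 6 * Aform z * Bform z * fderiv ℝ Aform z (0, 1)
    + 9 * Bform z * fderiv ℝ Bform z (1, 0)) /
  (4 * (Aform z) ^ 3 + 27 * (Bform z) ^ 2)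

/-- Second component `γ₂` of the Chern connection form. -/
noncomputable def gamma2 : ℝ × ℝ → ℝ := fun z =>
  (4 * (Aform z) ^ 2 * fderiv ℝ Aform z (0, 1) + 6 * Aform z * fderiv ℝ Bform z (1, 0)
    + 18 * Bform z * fderiv ℝ Bform z (0, 1) - 9 * Bform z * fderiv ℝ Aform z (1, 0)) /
  (4 * (Aform z) ^ 3 + 27 * (Bform z) ^ 2)

theorem fderiv_Aform (z : ℝ × ℝ) :
    fderiv ℝ Aform z = (2 * z.2) • ContinuousLinearMap.snd ℝ ℝ ℝ := by
  have h : HasFDerivAt Aform _ z := (hasFDerivAt_snd (𝕜 := ℝ) (p := z)).pow 2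
  rw [h.fderiv]
  ext <;> simp

theorem hasFDerivAt_tan_mul_fst (k : ℝ) {z : ℝ × ℝ} (hz : Real.cos (k * z.1) ≠ 0) :
    HasFDerivAt (fun w : ℝ × ℝ => Real.tan (k * w.1))
      ((k * (1 + Real.tan (k * z.1) ^ 2)) • ContinuousLinearMap.fst ℝ ℝ ℝ) z := by
  have h := (Real.hasDerivAt_tan hz).comp_hasFDerivAt z
    ((hasFDerivAt_fst (𝕜 := ℝ) (p := z)).const_mul k)
  refine h.congr_fderiv ?_
  rw [smul_smul, one_div, ← Real.inv_one_add_tan_sq hz, inv_inv, mul_comm]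

theorem fderiv_Bform {z : ℝ × ℝ} (hz : Real.cos (2 * Real.sqrt 3 * z.1) ≠ 0) :
    fderiv ℝ Bform z (1, 0) =
        -(4 / 3 * z.2 ^ 3 * (1 + Real.tan (2 * Real.sqrt 3 * z.1) ^ 2)) ∧
      fderiv ℝ Bform z (0, 1) =
        -(3 * (2 / Real.sqrt 27) * z.2 ^ 2 * Real.tan (2 * Real.sqrt 3 * z.1)) := by
  have h : HasFDerivAt Bform _ z :=
    ((((hasFDerivAt_snd (𝕜 := ℝ) (p := z)).pow 3).const_mul (2 / Real.sqrt 27)).mul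
      (hasFDerivAt_tan_mul_fst (2 * Real.sqrt 3) hz)).neg
  have h27 : 2 / Real.sqrt 27 * (2 * Real.sqrt 3) = 4 / 3 := by
    have : Real.sqrt 27 = 3 * Real.sqrt 3 := by
      rw [show (27 : ℝ) = 3 ^ 2 * 3 by norm_num, Real.sqrt_mul (by norm_num),
        Real.sqrt_sq (by norm_num)]
    rw [this]
    field_simp
    norm_num
  rw [h.fderiv]
  constructor
  · simp
    linear_combination (z.2 ^ 3 * (1 + Real.tan (2 * Real.sqrt 3 * z.1) ^ 2)) * h27
  · simp
    ring

theorem two_div_sqrt_sq : (2 / Real.sqrt 27) ^ 2 = 4 / 27 := by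
  rw [div_pow, Real.sq_sqrt (by norm_num)]
  norm_num

theorem discriminant_eq (z : ℝ × ℝ) :
    4 * (Aform z) ^ 3 + 27 * (Bform z) ^ 2 =
      4 * z.2 ^ 6 * (1 + Real.tan (2 * Real.sqrt 3 * z.1) ^ 2) := by
  simp only [Aform, Bform]
  linear_combination (27 * z.2 ^ 6 * Real.tan (2 * Real.sqrt 3 * z.1) ^ 2) * two_div_sqrt_sq

theorem gamma1_eq {z : ℝ × ℝ} (hy : z.2 ≠ 0) (hz : Real.cos (2 * Real.sqrt 3 * z.1) ≠ 0) :
    gamma1 z = 3 * (2 / Real.sqrt 27) * Real.tan (2 * Real.sqrt 3 * z.1) := by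
  have hd : 4 * z.2 ^ 6 * (1 + Real.tan (2 * Real.sqrt 3 * z.1) ^ 2) ≠ 0 := by positivity
  rw [gamma1, discriminant_eq, div_eq_iff hd, (fderiv_Bform hz).1, (fderiv_Bform hz).2,
    fderiv_Aform]
  simp [Aform, Bform]
  ring

theorem gamma2_eq_zero {z : ℝ × ℝ} (hz : Real.cos (2 * Real.sqrt 3 * z.1) ≠ 0) :
    gamma2 z = 0 := by
  rw [gamma2, (fderiv_Bform hz).1, (fderiv_Bform hz).2, fderiv_Aform, div_eq_zero_iff]
  left
  simp only [Aform, Bform, smul_apply, ContinuousLinearMap.coe_snd',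
    smul_eq_mul]
  linear_combination (54 * z.2 ^ 5 * Real.tan (2 * Real.sqrt 3 * z.1) ^ 2) * two_div_sqrt_sq

/-- For `A = y²`, `B = −(2/√27)y³ tan(2√3 x)` one has
`4A³ + 27B² = 4y⁶/cos²(2√3 x)` wherever `cos(2√3 x) ≠ 0`, and on
`{y ≠ 0, cos(2√3 x) ≠ 0}` the Chern connection form is closed: the web is flat. -/
theorem flatness_of_tangent_normal_form :
    (∀ z : ℝ × ℝ, Real.cos (2 * Real.sqrt 3 * z.1) ≠ 0 →
      4 * (Aform z) ^ 3 + 27 * (Bform z) ^ 2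
        = 4 * z.2 ^ 6 / (Real.cos (2 * Real.sqrt 3 * z.1)) ^ 2) ∧
    (∀ z : ℝ × ℝ, z.2 ≠ 0 → Real.cos (2 * Real.sqrt 3 * z.1) ≠ 0 →
      fderiv ℝ gamma1 z (0, 1) = fderiv ℝ gamma2 z (1, 0)) := by
  refine ⟨fun z hz => ?_, fun z hy hz => ?_⟩
  · rw [discriminant_eq, div_eq_mul_inv, ← Real.inv_one_add_tan_sq hz, inv_inv]
  · have hcos : ∀ᶠ w : ℝ × ℝ in nhds z, Real.cos (2 * Real.sqrt 3 * w.1) ≠ 0 :=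
      ContinuousAt.eventually_ne (by fun_prop) hz
    have hsnd : ∀ᶠ w : ℝ × ℝ in nhds z, w.2 ≠ 0 :=
      ContinuousAt.eventually_ne (by fun_prop) hy
    have h1 : gamma1 =ᶠ[nhds z]
        fun w => 3 * (2 / Real.sqrt 27) * Real.tan (2 * Real.sqrt 3 * w.1) := by
      filter_upwards [hcos, hsnd] with w hw hw' using gamma1_eq hw' hw
    have h2 : gamma2 =ᶠ[nhds z] fun _ => 0 := by
      filter_upwards [hcos] with w hw using gamma2_eq_zero hw
    rw [h1.fderiv_eq, h2.fderiv_eq,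
      ((hasFDerivAt_tan_mul_fst (2 * Real.sqrt 3) hz).const_mul _).fderiv]
    simp
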